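/- Let M be a ranked standpoint structure, let s, s₂, …, s_k ∈ S be standpoints, let φ₁, …, φ_k ∈ L^|~, and for each i ∈ {2, …, k} let #ⁱ be either □ or ◇. Then M ⊩ ◇_s(φ₁ ∧ #²_{s₂} φ₂ ∧ … ∧ #^k_{s_k} φ_k) if and only if M ⊩ ◇_s φ₁ ∧ #²_{s₂} φ₂ ∧ … ∧ #^k_{s_k} φ_k. -/

import Mathlib

/-- Boolean formulas over a set of atoms `P`. -/
inductive BForm (P : Type) : Type
  | atom : P → BForm P
  | fls  : BForm P
  | neg  : BForm P → BForm P
  | conj : BForm P → BForm P → BForm P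

/-- Evaluation of a Boolean formula under a classical valuation `u : P → Bool`. -/
def BForm.eval {P : Type} (u : P → Bool) : BForm P → Bool
  | .atom p => u p
  | .fls => false
  | .neg α => !(α.eval u)
  | .conj α β => α.eval u && β.eval u

/-- A ranked interpretation: `R : U → ℕ ∪ {∞}` satisfying convexity. -/
structure RankedInterp (P : Type) where
  rank : (P → Bool) → ℕ∞
  convex : ∀ u : P → Bool, rank u ≠ ⊤ → ∀ j : ℕ, (j : ℕ∞) < rank u →
    ∃ v : P → Bool, rank v = (j : ℕ∞)

/-- `R ⊩ α` iff every valuation of finite rank satisfies `α`. -/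
def RankedInterp.satB {P : Type} (R : RankedInterp P) (α : BForm P) : Prop :=
  ∀ u : P → Bool, R.rank u ≠ ⊤ → α.eval u = true

/-- `R ⊩ α |~ β` iff every `α`-valuation of minimal rank among `α`-valuations satisfies `β`. -/
def RankedInterp.satDI {P : Type} (R : RankedInterp P) (α β : BForm P) : Prop :=
  ∀ u : P → Bool, α.eval u = true →
    (∀ v : P → Bool, α.eval v = true → ¬ R.rank v < R.rank u) → β.eval u = true

/-- The propositional KLM language `L^|~` : φ ::= α | α |~ β | φ ∧ φ. -/
inductive KLM (P : Type) : Type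
  | bool : BForm P → KLM P
  | di : BForm P → BForm P → KLM P
  | conj : KLM P → KLM P → KLM P

/-- Satisfaction of KLM formulas by a ranked interpretation. -/
def RankedInterp.satKLM {P : Type} (R : RankedInterp P) : KLM P → Prop
  | .bool α => R.satB α
  | .di α β => R.satDI α β
  | .conj φ ψ => R.satKLM φ ∧ R.satKLM ψ

/-- The DRSL language `L^|~_S` (with sharpening statements included as formulas). -/
inductive DRSL (P S : Type) : Type
  | base : KLM P → DRSL P S
  | box : S → DRSL P S → DRSL P S
  | dia : S → DRSL P S → DRSL P S
  | conj : DRSL P S → DRSL P S → DRSL P S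
  | sharp : S → S → DRSL P S

/-- A ranked standpoint structure over precisifications `W`, with universal standpoint `sstar`. -/
structure RSS (P S : Type) (sstar : S) (W : Type) where
  wne : Nonempty W
  σ : S → Set W
  σne : ∀ s : S, (σ s).Nonempty
  σstar : σ sstar = Set.univ
  γ : W → RankedInterp P

/-- Satisfaction `M, π ⊩ ψ` at a precisification. -/
def RSS.sat {P S : Type} {sstar : S} {W : Type} (M : RSS P S sstar W) :
    W → DRSL P S → Prop
  | π, .base φ => (M.γ π).satKLM φ
  | _, .box s ψ => ∀ π' ∈ M.σ s, RSS.sat M π' ψ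
  | _, .dia s ψ => ∃ π' ∈ M.σ s, RSS.sat M π' ψ
  | π, .conj ψ₁ ψ₂ => RSS.sat M π ψ₁ ∧ RSS.sat M π ψ₂
  | _, .sharp s₁ s₂ => M.σ s₁ ⊆ M.σ s₂

/-- Global satisfaction `M ⊩ ψ`. -/
def RSS.gsat {P S : Type} {sstar : S} {W : Type} (M : RSS P S sstar W) (ψ : DRSL P S) : Prop :=
  ∀ π : W, M.sat π ψ

/-- `M` is a model of a knowledge base `K`. -/
def RSS.isModel {P S : Type} {sstar : S} {W : Type} (M : RSS P S sstar W)
    (K : Set (DRSL P S)) : Prop :=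
  ∀ ξ ∈ K, M.gsat ξ

/-- A modal operator `#`, either `□` or `◇`. -/
inductive MOp : Type
  | box
  | dia

/-- Application `#_s ψ` of a modal operator. -/
def MOp.app {P S : Type} : MOp → S → DRSL P S → DRSL P S
  | .box, s, ψ => .box s ψ
  | .dia, s, ψ => .dia s ψ

/-- Left-associated conjunction `ψ ∧ l₁ ∧ ... ∧ lₙ`. -/
def DRSL.chain {P S : Type} (ψ : DRSL P S) (l : List (DRSL P S)) : DRSL P S :=
  l.foldl DRSL.conj ψ

theorem RSS.sat_chain {P S : Type} {sstar : S} {W : Type} (M : RSS P S sstar W) (π : W)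
    (ψ : DRSL P S) (l : List (DRSL P S)) :
    M.sat π (ψ.chain l) ↔ M.sat π ψ ∧ ∀ χ ∈ l, M.sat π χ := by
  induction l generalizing ψ with
  | nil => simp [DRSL.chain]
  | cons χ l ih =>
    have h : ψ.chain (χ :: l) = (DRSL.conj ψ χ).chain l := rfl
    rw [h, ih]
    simp only [RSS.sat, List.forall_mem_cons, and_assoc]

/-- Satisfaction of a modal formula does not depend on the precisification. -/
theorem RSS.sat_app_iff {P S : Type} {sstar : S} {W : Type} (M : RSS P S sstar W) (π π' : W)
    (o : MOp) (s : S) (ψ : DRSL P S) : M.sat π (o.app s ψ) ↔ M.sat π' (o.app s ψ) := by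
  cases o <;> simp only [MOp.app, RSS.sat]

/-- `M ⊩ ◇_s(φ₁ ∧ #²_{s₂} φ₂ ∧ … ∧ #^k_{s_k} φ_k)` iff
`M ⊩ ◇_s φ₁ ∧ #²_{s₂} φ₂ ∧ … ∧ #^k_{s_k} φ_k`. -/
theorem dia_distributes_over_modal_conj {P S : Type} (sstar : S) {W : Type}
    (M : RSS P S sstar W) (s : S) (φ₁ : KLM P) (rest : List (MOp × S × KLM P)) :
    M.gsat (.dia s ((DRSL.base φ₁).chain
        (rest.map fun x => x.1.app x.2.1 (.base x.2.2)))) ↔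
    M.gsat ((DRSL.dia s (.base φ₁)).chain
        (rest.map fun x => x.1.app x.2.1 (.base x.2.2))) := by
  refine forall_congr' fun π => ?_
  simp only [RSS.sat, RSS.sat_chain, List.forall_mem_map]
  constructor
  · rintro ⟨π', hπ', hφ, h⟩
    exact ⟨⟨π', hπ', hφ⟩, fun x hx => (M.sat_app_iff π π' _ _ _).2 (h x hx)⟩
  · rintro ⟨⟨π', hπ', hφ⟩, h⟩
    exact ⟨π', hπ', hφ, fun x hx => (M.sat_app_iff π π' _ _ _).1 (h x hx)⟩
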